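/- Correctness of the epoch-based representation of dates: letting epoch = (2000, 3, 1), the map n ↦ epoch +D n is a bijection from ℤ onto the set of valid dates; that is, for every valid date D there exists a unique integer n with epoch +D n = D. -/

import Mathlib

/-- A date is a triple of integers (year, month, day). -/
structure Date where
  y : ℤ
  m : ℤ
  d : ℤ

/-- A year is a leap year iff divisible by 4 and (not by 100, or by 400). -/
def isLeap (y : ℤ) : Prop :=
  y % 4 = 0 ∧ (y % 100 ≠ 0 ∨ y % 400 = 0)

/-- Number of days in month `m` of year `y`. -/
def nbdays (y m : ℤ) : ℤ :=
  if m = 4 ∨ m = 6 ∨ m = 9 ∨ m = 11 then 30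
  else if m = 2 then
    (if y % 4 = 0 ∧ (y % 100 ≠ 0 ∨ y % 400 = 0) then 29 else 28)
  else 31

/-- A date is valid iff `1 ≤ m ≤ 12` and `1 ≤ d ≤ nbdays y m`. -/
def Date.valid (D : Date) : Prop :=
  1 ≤ D.m ∧ D.m ≤ 12 ∧ 1 ≤ D.d ∧ D.d ≤ nbdays D.y D.m

/-- Month addition `(y, m, d) +m n`, with round-down of the day component. -/
def addMonths (D : Date) (n : ℤ) : Date :=
  ⟨D.y + (D.m - 1 + n) / 12,
   1 + (D.m - 1 + n) % 12,
   min D.d (nbdays (D.y + (D.m - 1 + n) / 12) (1 + (D.m - 1 + n) % 12))⟩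

/-- A configuration of the small-step day-addition machine:
either a pending addition `D +D n`, or a finished date. -/
inductive Conf where
  | pending (D : Date) (n : ℤ)
  | done (D : Date)

/-- Small-step rules for day addition `+D`. -/
inductive Step : Conf → Conf → Prop where
  | add_days {y m d n : ℤ}
      (h1 : 1 ≤ d + n) (h2 : d + n ≤ nbdays y m) :
      Step (Conf.pending ⟨y, m, d⟩ n) (Conf.done ⟨y, m, d + n⟩)
  | add_days_over {y m d n : ℤ}
      (h : d + n > nbdays y m) :
      Step (Conf.pending ⟨y, m, d⟩ n)
        (Conf.pending (addMonths ⟨y, m, 1⟩ 1) (n - (nbdays y m - d) - 1))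
  | add_days_under1 {y m d n : ℤ}
      (h1 : 1 < d) (h2 : d + n ≤ 0) :
      Step (Conf.pending ⟨y, m, d⟩ n) (Conf.pending ⟨y, m, 1⟩ (d - 1 + n))
  | add_days_under2 {y m n y' m' : ℤ}
      (h1 : 1 + n ≤ 0) (h2 : addMonths ⟨y, m, 1⟩ (-1) = ⟨y', m', 1⟩) :
      Step (Conf.pending ⟨y, m, 1⟩ n) (Conf.pending ⟨y', m', 1⟩ (n + nbdays y' m'))

/-- Reduction in finitely many steps. -/
def Reduces : Conf → Conf → Prop := Relation.ReflTransGen Step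

instance : Nonempty Date := ⟨⟨2000, 3, 1⟩⟩

/-- `addDays D n` is the unique valid normal form of `D +D n`
(when it exists; arbitrary otherwise). -/
noncomputable def addDays (D : Date) (n : ℤ) : Date :=
  Classical.epsilon fun D' : Date =>
    D'.valid ∧ Reduces (Conf.pending D n) (Conf.done D')

/-- Date-period addition `D +P (ny, nm, nd) = (D +m (12·ny + nm)) +D nd`. -/
noncomputable def addPeriod (D : Date) (P : ℤ × ℤ × ℤ) : Date :=
  addDays (addMonths D (12 * P.1 + P.2.1)) P.2.2

/-- Lexicographic order on dates. -/
def Date.le (a b : Date) : Prop :=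
  a.y < b.y ∨ (a.y = b.y ∧ a.m < b.m) ∨ (a.y = b.y ∧ a.m = b.m ∧ a.d ≤ b.d)

/-- Strict lexicographic order on dates. -/
def Date.lt (a b : Date) : Prop :=
  a.y < b.y ∨ (a.y = b.y ∧ a.m < b.m) ∨ (a.y = b.y ∧ a.m = b.m ∧ a.d < b.d)

/-- The epoch date: March 1, 2000. -/
def epoch : Date := ⟨2000, 3, 1⟩

/-- `toDelta D` is the unique integer `n` with `epoch +D n = D`
(when it exists; arbitrary otherwise). -/
noncomputable def toDelta (D : Date) : ℤ :=
  Classical.epsilon fun n : ℤ => addDays epoch n = D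

/-- Number of days before the first day of month `m` of year `y`, counted (up to a constant)
with years that begin in March. -/
def monthStart (y m : ℤ) : ℤ :=
  if m ≤ 2 then
    365 * (y - 1) + (y - 1) / 4 - (y - 1) / 100 + (y - 1) / 400 + (153 * (m + 9) + 2) / 5
  else 365 * y + y / 4 - y / 100 + y / 400 + (153 * (m - 3) + 2) / 5

/-- The position of a date on the day line. -/
def Date.rank (D : Date) : ℤ := monthStart D.y D.m + D.d

theorem nbdays_pos (y m : ℤ) : 0 < nbdays y m := by
  unfold nbdays
  split_ifs <;> norm_num

theorem monthStart_succ {y m : ℤ} (h1 : 1 ≤ m) (h2 : m < 12) :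
    monthStart y (m + 1) = monthStart y m + nbdays y m := by
  unfold monthStart nbdays
  interval_cases m <;> norm_num <;> (try split_ifs) <;> omega

theorem monthStart_next_year (y : ℤ) :
    monthStart (y + 1) 1 = monthStart y 12 + nbdays y 12 := by
  unfold monthStart nbdays
  norm_num
  omega

/-- `monthStart` as a function of the number of months since year `0`. -/
def monthIndexStart (k : ℤ) : ℤ := monthStart (k / 12) (1 + k % 12)

theorem monthIndexStart_succ (k : ℤ) :
    monthIndexStart (k + 1) = monthIndexStart k + nbdays (k / 12) (1 + k % 12) := by
  unfold monthIndexStart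
  by_cases h : k % 12 = 11
  · rw [show (k + 1) / 12 = k / 12 + 1 by omega, show (k + 1) % 12 = 0 by omega, h]
    exact monthStart_next_year _
  · rw [show (k + 1) / 12 = k / 12 by omega, show 1 + (k + 1) % 12 = 1 + k % 12 + 1 by omega]
    exact monthStart_succ (by omega) (by omega)

theorem monthIndexStart_strictMono : StrictMono monthIndexStart :=
  strictMono_int_of_lt_succ fun k => by
    rw [monthIndexStart_succ]
    linarith [nbdays_pos (k / 12) (1 + k % 12)]

theorem monthIndex_div_mod {y m : ℤ} (h1 : 1 ≤ m) (h2 : m ≤ 12) :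
    (12 * y + (m - 1)) / 12 = y ∧ 1 + (12 * y + (m - 1)) % 12 = m := by
  omega

theorem Date.rank_bounds {D : Date} (h : D.valid) :
    monthIndexStart (12 * D.y + (D.m - 1)) < D.rank ∧
      D.rank ≤ monthIndexStart (12 * D.y + (D.m - 1) + 1) := by
  obtain ⟨h1, h2, h3, h4⟩ := h
  obtain ⟨hy, hm⟩ := monthIndex_div_mod (y := D.y) h1 h2
  rw [monthIndexStart_succ, monthIndexStart, hy, hm, Date.rank]
  constructor <;> linarith

theorem Date.rank_injOn : Set.InjOn Date.rank {D | D.valid} := by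
  intro D hD E hE h
  obtain ⟨hD1, hD2⟩ := Date.rank_bounds hD
  obtain ⟨hE1, hE2⟩ := Date.rank_bounds hE
  have a := monthIndexStart_strictMono.lt_iff_lt.1 (hD1.trans_le (h.trans_le hE2))
  have b := monthIndexStart_strictMono.lt_iff_lt.1 (hE1.trans_le (h.symm.trans_le hD2))
  obtain ⟨y, m, d⟩ := D
  obtain ⟨y', m', d'⟩ := E
  obtain ⟨c1, c2, -, -⟩ := hD
  obtain ⟨c3, c4, -, -⟩ := hE
  dsimp only at *
  obtain rfl : y = y' := by omega
  obtain rfl : m = m' := by omega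
  simpa [Date.rank] using h

/-- Adding months to a first of the month again gives a first of the month. -/
theorem addMonths_first (y m n : ℤ) :
    addMonths ⟨y, m, 1⟩ n = ⟨y + (m - 1 + n) / 12, 1 + (m - 1 + n) % 12, 1⟩ := by
  simp only [addMonths, Date.mk.injEq, true_and]
  exact min_eq_left (nbdays_pos _ _)

theorem addMonths_first_month (y m n : ℤ) :
    1 ≤ (addMonths ⟨y, m, 1⟩ n).m ∧ (addMonths ⟨y, m, 1⟩ n).m ≤ 12 := by
  rw [addMonths_first]
  dsimp only
  omega

theorem rank_addMonths_one {y m : ℤ} (h1 : 1 ≤ m) (h2 : m ≤ 12) :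
    (addMonths ⟨y, m, 1⟩ 1).rank = monthStart y m + nbdays y m + 1 := by
  have h := monthIndexStart_succ (12 * y + (m - 1))
  obtain ⟨hy, hm⟩ := monthIndex_div_mod (y := y) h1 h2
  rw [hy, hm, monthIndexStart, monthIndexStart, hy, hm] at h
  rw [addMonths_first, Date.rank, ← h]
  dsimp only
  rw [show (12 * y + (m - 1) + 1) / 12 = y + (m - 1 + 1) / 12 by omega,
    show (12 * y + (m - 1) + 1) % 12 = (m - 1 + 1) % 12 by omega]

theorem monthStart_eq_of_addMonths_neg_one {y m y' m' : ℤ} (h1 : 1 ≤ m) (h2 : m ≤ 12)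
    (h : addMonths ⟨y, m, 1⟩ (-1) = ⟨y', m', 1⟩) :
    monthStart y m = monthStart y' m' + nbdays y' m' := by
  rw [addMonths_first] at h
  obtain ⟨rfl, rfl, -⟩ := Date.mk.injEq .. ▸ h
  have h := monthIndexStart_succ (12 * y + (m - 1) + -1)
  obtain ⟨hy, hm⟩ := monthIndex_div_mod (y := y) h1 h2
  rw [neg_add_cancel_right, monthIndexStart, monthIndexStart, hy, hm] at h
  rw [h, show (12 * y + (m - 1) + -1) / 12 = y + (m - 1 + -1) / 12 by omega,
    show (12 * y + (m - 1) + -1) % 12 = (m - 1 + -1) % 12 by omega]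

/-- A configuration stands for the day with position `r`; a finished one is valid. -/
def Conf.Denotes (r : ℤ) : Conf → Prop
  | .pending D n => 1 ≤ D.m ∧ D.m ≤ 12 ∧ D.rank + n = r
  | .done D => D.valid ∧ D.rank = r

theorem Step.denotes {r : ℤ} {c c' : Conf} (h : Step c c') (hc : c.Denotes r) :
    c'.Denotes r := by
  cases h with
  | add_days h1 h2 =>
    obtain ⟨a, b, e⟩ := hc
    exact ⟨⟨a, b, h1, h2⟩, by simp only [Date.rank] at e ⊢; linarith⟩
  | add_days_over h =>
    obtain ⟨a, b, e⟩ := hc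
    refine ⟨(addMonths_first_month _ _ _).1, (addMonths_first_month _ _ _).2, ?_⟩
    rw [rank_addMonths_one a b]
    simp only [Date.rank] at e
    linarith
  | add_days_under1 h1 h2 =>
    obtain ⟨a, b, e⟩ := hc
    exact ⟨a, b, by simp only [Date.rank] at e ⊢; linarith⟩
  | @add_days_under2 y m n y' m' h1 h2 =>
    obtain ⟨a, b, e⟩ := hc
    have hm := addMonths_first_month y m (-1)
    rw [h2] at hm
    have := monthStart_eq_of_addMonths_neg_one a b h2
    exact ⟨hm.1, hm.2, by simp only [Date.rank] at e ⊢; linarith⟩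

theorem Reduces.denotes {r : ℤ} {c c' : Conf} (h : Reduces c c') (hc : c.Denotes r) :
    c'.Denotes r := by
  induction h with
  | refl => exact hc
  | tail _ h ih => exact h.denotes ih

theorem exists_reduces_of_nonneg (k : ℕ) :
    ∀ y m n : ℤ, 0 ≤ n → n ≤ k → ∃ D, Reduces (.pending ⟨y, m, 1⟩ n) (.done D) := by
  induction k with
  | zero =>
    intro y m n h0 hn
    exact ⟨_, .single (.add_days (by omega) (by have := nbdays_pos y m; push_cast at hn; omega))⟩
  | succ k ih =>
    intro y m n h0 hn
    by_cases h : 1 + n ≤ nbdays y m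
    · exact ⟨_, .single (.add_days (by omega) h)⟩
    · have hp := nbdays_pos y m
      push_cast at hn
      have hs : Step (.pending ⟨y, m, 1⟩ n) _ := .add_days_over (by omega)
      rw [addMonths_first] at hs
      obtain ⟨D, hD⟩ := ih (y + (m - 1 + 1) / 12) (1 + (m - 1 + 1) % 12)
        (n - (nbdays y m - 1) - 1) (by omega) (by omega)
      exact ⟨D, .head hs hD⟩

theorem exists_reduces_of_neg_le (k : ℕ) :
    ∀ y m n : ℤ, -n ≤ k → ∃ D, Reduces (.pending ⟨y, m, 1⟩ n) (.done D) := by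
  induction k with
  | zero =>
    intro y m n hn
    exact exists_reduces_of_nonneg n.toNat y m n (by simpa using hn) (by omega)
  | succ k ih =>
    intro y m n hn
    by_cases h : 0 ≤ n
    · exact exists_reduces_of_nonneg n.toNat y m n h (by omega)
    · push_cast at hn
      have hs := Step.add_days_under2 (n := n) (by omega) (addMonths_first y m (-1))
      have hp := nbdays_pos (y + (m - 1 + -1) / 12) (1 + (m - 1 + -1) % 12)
      obtain ⟨D, hD⟩ := ih _ _ (n + nbdays (y + (m - 1 + -1) / 12) (1 + (m - 1 + -1) % 12))
        (by omega)
      exact ⟨D, .head hs hD⟩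

theorem addDays_epoch_spec (n : ℤ) :
    (addDays epoch n).valid ∧ (addDays epoch n).rank = epoch.rank + n := by
  have hc : (Conf.pending epoch n).Denotes (epoch.rank + n) :=
    ⟨by norm_num [epoch], by norm_num [epoch], rfl⟩
  obtain ⟨D, hD⟩ := exists_reduces_of_neg_le (-n).toNat 2000 3 n (by omega)
  have hs : Reduces (.pending epoch n) (.done (addDays epoch n)) :=
    (Classical.epsilon_spec (p := fun D' : Date =>
      D'.valid ∧ Reduces (Conf.pending epoch n) (Conf.done D')) ⟨D, (hD.denotes hc).1, hD⟩).2
  exact hs.denotes hc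

/-- **Correctness of the epoch-based representation**: with `epoch = (2000, 3, 1)`, the
map `n ↦ epoch +D n` is a bijection from `ℤ` onto the set of valid dates: it only
produces valid dates, and every valid date `D` has a unique `n` with
`epoch +D n = D`. -/
theorem epoch_bijection :
    (∀ n : ℤ, (addDays epoch n).valid) ∧
    (∀ D : Date, D.valid → ∃! n : ℤ, addDays epoch n = D) := by
  refine ⟨fun n => (addDays_epoch_spec n).1, fun D hD => ⟨D.rank - epoch.rank, ?_, ?_⟩⟩
  · obtain ⟨hv, hr⟩ := addDays_epoch_spec (D.rank - epoch.rank)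
    exact Date.rank_injOn hv hD (by rw [hr]; ring)
  · rintro n rfl
    rw [(addDays_epoch_spec n).2]
    ring
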